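/- Let X be a Banach space such that there exists C > 0 with ∫₀¹ ‖∑_{k=-n}^{n} e^{2πikt} • xₖ‖² dt ≤ C ∑_{k=-n}^n ‖xₖ‖² and C⁻¹ ∑_{k=-n}^n ‖xₖ‖² ≤ ∫₀¹ ‖∑_{k=-n}^{n} e^{2πikt} • xₖ‖² dt for all n and all x_{-n},…,xₙ ∈ X. Then X is isomorphic to a Hilbert space. -/

import Mathlib

open scoped Real
open MeasureTheory Metric

/-- Lebesgue measure on the closed unit ball of `ℂ^ι`. -/
noncomputable def ballMeasure (ι : Type*) [Fintype ι] : Measure (EuclideanSpace ℂ ι) :=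
  volume.restrict (closedBall 0 1)

section Ball

variable {ι : Type*} [Fintype ι]

instance : IsFiniteMeasure (ballMeasure ι) :=
  ⟨by simpa [ballMeasure] using measure_closedBall_lt_top⟩

lemma measurePreserving_ballMeasure (U : EuclideanSpace ℂ ι ≃ₗᵢ[ℝ] EuclideanSpace ℂ ι) :
    MeasurePreserving U (ballMeasure ι) (ballMeasure ι) := by
  have hU := U.measurePreserving.restrict_preimage
    (s := closedBall 0 1) isClosed_closedBall.measurableSet
  have : U ⁻¹' closedBall 0 1 = closedBall 0 1 := by
    ext g; simp
  rwa [this] at hU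

lemma integral_comp_ballMeasure {F : Type*} [NormedAddCommGroup F] [NormedSpace ℝ F]
    (U : EuclideanSpace ℂ ι ≃ₗᵢ[ℝ] EuclideanSpace ℂ ι) (f : EuclideanSpace ℂ ι → F) :
    ∫ g, f (U g) ∂ballMeasure ι = ∫ g, f g ∂ballMeasure ι :=
  (measurePreserving_ballMeasure U).integral_comp U.toHomeomorph.measurableEmbedding f

lemma integrable_ballMeasure {f : EuclideanSpace ℂ ι → ℝ} (hf : Continuous f) :
    Integrable f (ballMeasure ι) :=
  hf.continuousOn.integrableOn_compact (isCompact_closedBall 0 1)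

lemma integral_norm_coord_sq_eq (i j : ι) :
    ∫ g, ‖g i‖ ^ 2 ∂ballMeasure ι = ∫ g, ‖g j‖ ^ 2 ∂ballMeasure ι := by
  classical
  rw [← integral_comp_ballMeasure
    (LinearIsometryEquiv.piLpCongrLeft 2 ℝ ℂ (Equiv.swap i j)) (fun g ↦ ‖g i‖ ^ 2)]
  simp [LinearIsometryEquiv.piLpCongrLeft_apply, Equiv.piCongrLeft']

lemma integral_norm_coord_sq_pos (i : ι) : 0 < ∫ g, ‖g i‖ ^ 2 ∂ballMeasure ι := by
  classical
  have hc : Continuous fun g : EuclideanSpace ℂ ι ↦ ‖g i‖ ^ 2 := by fun_prop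
  rw [ballMeasure, setIntegral_pos_iff_support_of_nonneg_ae
    (Filter.Eventually.of_forall fun g ↦ sq_nonneg _) (integrable_ballMeasure hc)]
  have ho : IsOpen ((Function.support fun g : EuclideanSpace ℂ ι ↦ ‖g i‖ ^ 2) ∩ ball 0 1) :=
    hc.isOpen_support.inter isOpen_ball
  refine (ho.measure_pos volume ⟨EuclideanSpace.single i (1 / 2), ?_, ?_⟩).trans_le
    (measure_mono (Set.inter_subset_inter_right _ ball_subset_closedBall))
  · simp
  · simp; norm_num

lemma exists_integral_norm_coord_sq (ι : Type*) [Fintype ι] :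
    ∃ c : ℝ, 0 < c ∧ ∀ i : ι, ∫ g, ‖g i‖ ^ 2 ∂ballMeasure ι = c := by
  rcases isEmpty_or_nonempty ι with h | ⟨⟨i⟩⟩
  · exact ⟨1, one_pos, fun i ↦ h.elim i⟩
  · exact ⟨_, integral_norm_coord_sq_pos i, fun j ↦ integral_norm_coord_sq_eq j i⟩

end Ball

section Average

variable {ι : Type*} [Fintype ι] {X : Type*} [NormedAddCommGroup X] [NormedSpace ℂ X]

/-- The square mean of `∑ j, conj (g j) • x j` over `g` in the unit ball of `ℂ^ι`. -/
noncomputable def ballAverage (x : ι → X) : ℝ :=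
  ∫ g, ‖∑ j, star (g j) • x j‖ ^ 2 ∂ballMeasure ι

/-- The unitary matrix of `U`, applied to the tuple `x` of vectors. -/
noncomputable def unitaryAct (U : EuclideanSpace ℂ ι ≃ₗᵢ[ℂ] EuclideanSpace ℂ ι) (x : ι → X) :
    ι → X :=
  open Classical in fun i ↦ ∑ j, U (EuclideanSpace.single j 1) i • x j

lemma ballAverage_unitaryAct (U : EuclideanSpace ℂ ι ≃ₗᵢ[ℂ] EuclideanSpace ℂ ι) (x : ι → X) :
    ballAverage (unitaryAct U x) = ballAverage x := by
  classical
  unfold ballAverage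
  let V : EuclideanSpace ℂ ι ≃ₗᵢ[ℝ] EuclideanSpace ℂ ι :=
    { U.symm.toLinearEquiv.restrictScalars ℝ with norm_map' := U.symm.norm_map }
  have hV (g) : V g = U.symm g := rfl
  rw [← integral_comp_ballMeasure V (fun g ↦ ‖∑ j, star (g j) • x j‖ ^ 2)]
  simp only [hV]
  congr! 4 with g
  simp only [unitaryAct, Finset.smul_sum, smul_smul]
  rw [Finset.sum_comm]
  refine Finset.sum_congr rfl fun j _ ↦ ?_
  rw [← Finset.sum_smul]
  congr 1
  have h := U.inner_map_eq_flip (EuclideanSpace.single j 1) g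
  have h' := congrArg star h
  simp only [PiLp.inner_apply] at h'
  simpa [mul_comm] using h'

lemma ballAverage_smul (u : ι → Circle) (x : ι → X) :
    ballAverage (fun j ↦ (u j : ℂ) • x j) = ballAverage x := by
  unfold ballAverage
  rw [← integral_comp_ballMeasure (LinearIsometryEquiv.piLpCongrRight 2 fun j ↦ rotation (u j))
    (fun g ↦ ‖∑ j, star (g j) • (u j : ℂ) • x j‖ ^ 2)]
  have h (j : ι) (z : ℂ) : star ((u j : ℂ) * z) * (u j : ℂ) = star z := by
    have : star (u j : ℂ) * u j = 1 := by
      rw [Complex.star_def, Complex.conj_mul', Circle.norm_coe]; simp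
    rw [star_mul, mul_assoc, this, mul_one]
  simp only [LinearIsometryEquiv.piLpCongrRight_apply, rotation_apply, smul_smul, h]

end Average

lemma integral_ballAverage_swap {ι : Type*} [Fintype ι] {X : Type*} [NormedAddCommGroup X]
    [NormedSpace ℂ X] (u : ι → ℝ → ℂ) (hu : ∀ j, Continuous (u j)) (x : ι → X) :
    ∫ t in (0 : ℝ)..1, ballAverage (fun j ↦ u j t • x j) =
      ∫ g, (∫ t in (0 : ℝ)..1, ‖∑ j, u j t • star (g j) • x j‖ ^ 2) ∂ballMeasure ι := by
  simp only [ballAverage, intervalIntegral.integral_of_le zero_le_one, smul_comm (u _ _)]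
  refine integral_integral_swap ?_
  have hc : Continuous (Function.uncurry fun (t : ℝ) (g : EuclideanSpace ℂ ι) ↦
      ‖∑ j, star (g j) • u j t • x j‖ ^ 2) := by
    unfold Function.uncurry
    fun_prop
  have hK : IsCompact (Set.Icc (0 : ℝ) 1 ×ˢ closedBall (0 : EuclideanSpace ℂ ι) 1) :=
    isCompact_Icc.prod (isCompact_closedBall 0 1)
  rw [ballMeasure, Measure.prod_restrict]
  exact (hc.continuousOn.integrableOn_compact hK).mono_set
    (Set.prod_mono_left Set.Ioc_subset_Icc_self)

/-- The character `t ↦ e^{2πikt}` of the torus. -/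
noncomputable def torusChar (k : ℤ) (t : ℝ) : ℂ := Complex.exp (2 * π * Complex.I * k * t)

lemma continuous_torusChar (k : ℤ) : Continuous (torusChar k) := by
  unfold torusChar; fun_prop

lemma exists_circle_eq_torusChar (k : ℤ) (t : ℝ) : ∃ u : Circle, (u : ℂ) = torusChar k t :=
  ⟨Circle.exp (2 * π * k * t), by rw [Circle.coe_exp, torusChar]; push_cast; congr 1; ring⟩

section TrigEnergy
variable {ι : Type*} [Fintype ι] {X : Type*} [NormedAddCommGroup X] [NormedSpace ℂ X]

/-- The squared `L²` norm of the vector-valued trigonometric polynomial with frequencies `k` and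
coefficients `x`. -/
noncomputable def trigEnergy (k : ι → ℤ) (x : ι → X) : ℝ :=
  ∫ t in (0 : ℝ)..1, ‖∑ j, torusChar (k j) t • x j‖ ^ 2

lemma ballAverage_eq_integral_trigEnergy (k : ι → ℤ) (x : ι → X) :
    ballAverage x = ∫ g, trigEnergy k (fun j ↦ star (g j) • x j) ∂ballMeasure ι := by
  unfold trigEnergy
  rw [← integral_ballAverage_swap _ (fun j ↦ continuous_torusChar (k j))]
  have h (t : ℝ) : ballAverage (fun j ↦ torusChar (k j) t • x j) = ballAverage x := by
    choose u hu using fun j ↦ exists_circle_eq_torusChar (k j) t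
    simp only [← hu, ballAverage_smul]
  simp [h]

lemma continuous_trigEnergy (k : ι → ℤ) (x : ι → X) :
    Continuous fun g : EuclideanSpace ℂ ι ↦ trigEnergy k (fun j ↦ star (g j) • x j) := by
  have := fun j ↦ continuous_torusChar (k j)
  unfold trigEnergy
  refine intervalIntegral.continuous_parametric_intervalIntegral_of_continuous' ?_ 0 1
  unfold Function.uncurry
  fun_prop

lemma integral_sum_norm_sq {c : ℝ} (hc : ∀ i : ι, ∫ g, ‖g i‖ ^ 2 ∂ballMeasure ι = c)
    (x : ι → X) :
    ∫ g, ∑ j, ‖star (g j) • x j‖ ^ 2 ∂ballMeasure ι = c * ∑ j, ‖x j‖ ^ 2 := by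
  rw [integral_finsetSum _ fun j _ ↦ integrable_ballMeasure (by fun_prop), Finset.mul_sum]
  refine Finset.sum_congr rfl fun j _ ↦ ?_
  simp [norm_smul, mul_pow, integral_mul_const, hc]

lemma sum_norm_sq_unitaryAct_le {C : ℝ} (hC : 0 < C) (k : ι → ℤ)
    (hu : ∀ x : ι → X, trigEnergy k x ≤ C * ∑ j, ‖x j‖ ^ 2)
    (hl : ∀ x : ι → X, C⁻¹ * ∑ j, ‖x j‖ ^ 2 ≤ trigEnergy k x)
    (U : EuclideanSpace ℂ ι ≃ₗᵢ[ℂ] EuclideanSpace ℂ ι) (x : ι → X) :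
    ∑ j, ‖unitaryAct U x j‖ ^ 2 ≤ C ^ 2 * ∑ j, ‖x j‖ ^ 2 := by
  obtain ⟨c, hc0, hc⟩ := exists_integral_norm_coord_sq ι
  have hi (x : ι → X) := integrable_ballMeasure (continuous_trigEnergy k x)
  have hs (x : ι → X) : Integrable (fun g : EuclideanSpace ℂ ι ↦ ∑ j, ‖star (g j) • x j‖ ^ 2)
      (ballMeasure ι) := integrable_ballMeasure (by fun_prop)
  have upper : ballAverage x ≤ C * (c * ∑ j, ‖x j‖ ^ 2) := by
    rw [ballAverage_eq_integral_trigEnergy k, ← integral_sum_norm_sq hc, ← integral_const_mul]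
    exact integral_mono (hi x) ((hs x).const_mul C) fun g ↦ hu _
  have lower : C⁻¹ * (c * ∑ j, ‖unitaryAct U x j‖ ^ 2) ≤ ballAverage x := by
    rw [← ballAverage_unitaryAct U, ballAverage_eq_integral_trigEnergy k,
      ← integral_sum_norm_sq hc, ← integral_const_mul]
    exact integral_mono ((hs _).const_mul _) (hi _) fun g ↦ hl _
  have h := lower.trans upper
  rw [inv_mul_le_iff₀ hC] at h
  refine le_of_mul_le_mul_left (h.trans_eq ?_) hc0
  ring

end TrigEnergy

theorem LinearMap.exists_linearIsometryEquiv_comp_eq {M E : Type*} [AddCommGroup M] [Module ℂ M]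
    [NormedAddCommGroup E] [InnerProductSpace ℂ E] [FiniteDimensional ℂ E] (S R : M →ₗ[ℂ] E)
    (h : ∀ m, ‖R m‖ = ‖S m‖) : ∃ U : E ≃ₗᵢ[ℂ] E, ∀ m, U (S m) = R m := by
  have hker : LinearMap.ker S ≤ LinearMap.ker R := fun m hm ↦ by
    rw [LinearMap.mem_ker, ← norm_eq_zero, h, LinearMap.mem_ker.1 hm, norm_zero]
  let T : LinearMap.range S →ₗ[ℂ] E :=
    (LinearMap.ker S).liftQ R hker ∘ₗ S.quotKerEquivRange.symm.toLinearMap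
  have hT (m : M) : T ⟨S m, LinearMap.mem_range_self S m⟩ = R m := by
    have : S.quotKerEquivRange.symm ⟨S m, LinearMap.mem_range_self S m⟩
        = (LinearMap.ker S).mkQ m := by
      rw [LinearEquiv.symm_apply_eq]; rfl
    simp [T, this]
  let L : LinearMap.range S →ₗᵢ[ℂ] E := ⟨T, by
    rintro ⟨_, m, rfl⟩
    rw [hT, h]; rfl⟩
  refine ⟨L.extend.toLinearIsometryEquiv rfl, fun m ↦ ?_⟩
  exact (L.extend_apply ⟨S m, LinearMap.mem_range_self S m⟩).trans (hT m)

section UnitaryAct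
variable {ι : Type*} [Fintype ι] {X : Type*} [NormedAddCommGroup X] [NormedSpace ℂ X]

theorem exists_unitaryAct_eq (x y : ι → X)
    (h : ∀ φ : StrongDual ℂ X, ∑ i, ‖φ (x i)‖ ^ 2 = ∑ i, ‖φ (y i)‖ ^ 2) :
    ∃ U : EuclideanSpace ℂ ι ≃ₗᵢ[ℂ] EuclideanSpace ℂ ι, unitaryAct U y = x := by
  classical
  let S (x : ι → X) : StrongDual ℂ X →ₗ[ℂ] EuclideanSpace ℂ ι :=
    { toFun := fun φ ↦ WithLp.toLp 2 fun i ↦ φ (x i)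
      map_add' := fun φ ψ ↦ rfl
      map_smul' := fun c φ ↦ rfl }
  have hS_apply (x : ι → X) (φ) (i) : S x φ i = φ (x i) := rfl
  clear_value S
  have hS (x : ι → X) (φ) : S x φ = ∑ i, φ (x i) • EuclideanSpace.single i (1 : ℂ) := by
    ext j
    simp [hS_apply, Finset.sum_apply, Pi.single_apply]
  obtain ⟨U, hU⟩ := LinearMap.exists_linearIsometryEquiv_comp_eq (S y) (S x) fun φ ↦ by
    simp [EuclideanSpace.norm_eq, hS_apply, h]
  refine ⟨U, funext fun i ↦ ?_⟩
  refine (SeparatingDual.eq_iff_forall_dual_eq (R := ℂ)).2 fun φ ↦ ?_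
  have := congrArg (fun v : EuclideanSpace ℂ ι ↦ v i) (hU φ)
  rw [hS y] at this
  simpa [unitaryAct, hS_apply, mul_comm] using this
end UnitaryAct

section Form
variable {X : Type*} [NormedAddCommGroup X] [NormedSpace ℂ X]

/-- The rank-one positive tensor of `x`, as a function on the dual. -/
noncomputable def dualSq (x : X) (φ : StrongDual ℂ X) : ℝ := ‖φ x‖ ^ 2

variable (X) in
/-- The real span of the rank-one positive tensors. -/
abbrev DualSqSpan : Submodule ℝ (StrongDual ℂ X → ℝ) := Submodule.span ℝ (Set.range dualSq)

/-- `dualSq x` as an element of the span. -/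
noncomputable def dualSqMk (x : X) : DualSqSpan X := ⟨dualSq x, Submodule.subset_span ⟨x, rfl⟩⟩

/-- The cone of pairs `(F, r)` such that `F` is a difference of two sums of rank-one tensors whose
weighted square norms differ by at most `r`. -/
noncomputable def dualCone (X : Type*) [NormedAddCommGroup X] [NormedSpace ℂ X] (K : ℝ) :
    PointedCone ℝ (DualSqSpan X × ℝ) where
  carrier := {p | ∃ (ι : Type) (_ : Fintype ι) (x y : ι → X),
    (∑ i, dualSq (x i) = p.1.1 + ∑ i, dualSq (y i)) ∧
      K * ∑ i, ‖y i‖ ^ 2 - ∑ i, ‖x i‖ ^ 2 ≤ p.2}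
  zero_mem' := ⟨Empty, inferInstance, Empty.elim, Empty.elim, by simp, by simp⟩
  add_mem' := by
    rintro p q ⟨ι, _, x, y, h, hp⟩ ⟨κ, _, z, w, h', hq⟩
    refine ⟨ι ⊕ κ, inferInstance, Sum.elim x z, Sum.elim y w, ?_, ?_⟩
    · simp only [Fintype.sum_sum_type, Sum.elim_inl, Sum.elim_inr, h, h', Prod.fst_add,
        Submodule.coe_add]
      abel
    · simp only [Fintype.sum_sum_type, Sum.elim_inl, Sum.elim_inr, Prod.snd_add]
      linarith
  smul_mem' := by
    rintro ⟨r, hr⟩ p ⟨ι, _, x, y, h, hp⟩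
    have hs (u : X) : dualSq ((√r : ℂ) • u) = r • dualSq u := by
      ext φ
      simp [dualSq, mul_pow, Real.sq_sqrt hr]
    have hn (u : X) : ‖(√r : ℂ) • u‖ ^ 2 = r * ‖u‖ ^ 2 := by
      simp [norm_smul, mul_pow, Real.sq_sqrt hr]
    refine ⟨ι, inferInstance, fun i ↦ (√r : ℂ) • x i, fun i ↦ (√r : ℂ) • y i, ?_, ?_⟩
    · simp only [hs, ← Finset.smul_sum, h, smul_add]
      rfl
    · simp only [hn, ← Finset.mul_sum]
      change _ ≤ r * p.2
      have := mul_le_mul_of_nonneg_left hp hr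
      linarith

lemma exists_eq_sum_dualSq_sub (F : DualSqSpan X) : ∃ (ι : Type) (_ : Fintype ι) (x y : ι → X),
    ∑ i, dualSq (x i) = F.1 + ∑ i, dualSq (y i) := by
  obtain ⟨F, hF⟩ := F
  change ∃ (ι : Type) (_ : Fintype ι) (x y : ι → X), ∑ i, dualSq (x i) = F + ∑ i, dualSq (y i)
  induction hF using Submodule.span_induction with
  | mem F h =>
    obtain ⟨x, rfl⟩ := h
    refine ⟨Unit, inferInstance, fun _ ↦ x, fun _ ↦ 0, ?_⟩
    ext φ
    simp [dualSq]
  | zero => exact ⟨Empty, inferInstance, Empty.elim, Empty.elim, by simp⟩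
  | add F G _ _ hF hG =>
    obtain ⟨ι, _, x, y, h⟩ := hF
    obtain ⟨κ, _, z, w, h'⟩ := hG
    refine ⟨ι ⊕ κ, inferInstance, Sum.elim x z, Sum.elim y w, ?_⟩
    simp only [Fintype.sum_sum_type, Sum.elim_inl, Sum.elim_inr, h, h']
    abel
  | smul r F _ hF =>
    obtain ⟨ι, _, x, y, h⟩ := hF
    have hs (u : X) : dualSq ((√|r| : ℂ) • u) = |r| • dualSq u := by
      ext φ
      simp [dualSq, mul_pow, Real.sq_sqrt (abs_nonneg r)]
    have hs' (z : ι → X) : ∑ i, dualSq ((√|r| : ℂ) • z i) = |r| • ∑ i, dualSq (z i) := by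
      simp only [hs, Finset.smul_sum]
    rcases le_total 0 r with hr | hr
    · refine ⟨ι, inferInstance, fun i ↦ (√|r| : ℂ) • x i, fun i ↦ (√|r| : ℂ) • y i, ?_⟩
      rw [hs', hs', h, smul_add, abs_of_nonneg hr]
    · refine ⟨ι, inferInstance, fun i ↦ (√|r| : ℂ) • y i, fun i ↦ (√|r| : ℂ) • x i, ?_⟩
      rw [hs', hs', h, abs_of_nonpos hr]
      module

theorem exists_functional_dualSq {K : ℝ}
    (hK : ∀ (ι : Type) [Fintype ι] (x y : ι → X), ∑ i, dualSq (x i) = ∑ i, dualSq (y i) →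
      ∑ i, ‖x i‖ ^ 2 ≤ K * ∑ i, ‖y i‖ ^ 2) :
    ∃ q : DualSqSpan X →ₗ[ℝ] ℝ,
      ∀ x, ‖x‖ ^ 2 ≤ q (dualSqMk x) ∧ q (dualSqMk x) ≤ K * ‖x‖ ^ 2 := by
  have h0 : ((0, 1) : DualSqSpan X × ℝ) ≠ 0 := by simp
  let f : (DualSqSpan X × ℝ) →ₗ.[ℝ] ℝ := LinearPMap.mkSpanSingleton (0, 1) 1 h0
  have hf (r : ℝ) (hr) : f ⟨r • (0, 1), hr⟩ = r := by
    exact (LinearPMap.mkSpanSingleton'_apply ((0, 1) : DualSqSpan X × ℝ) (1 : ℝ) _ r hr).trans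
      (mul_one r)
  have hmem (r : ℝ) : r • ((0, 1) : DualSqSpan X × ℝ) ∈ f.domain :=
    Submodule.smul_mem _ _ (Submodule.mem_span_singleton_self _)
  obtain ⟨g, hg, hg0⟩ := riesz_extension (dualCone X K) f
    (by
      rintro ⟨p, hp⟩ hps
      obtain ⟨r, rfl⟩ := Submodule.mem_span_singleton.1 hp
      rw [hf]
      obtain ⟨ι, _, x, y, h, hr⟩ := hps
      have := hK ι x y (by simpa using h)
      simp only [Prod.smul_mk, smul_eq_mul, mul_one] at hr
      linarith)
    (by
      rintro ⟨F, r⟩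
      obtain ⟨ι, _, x, y, h⟩ := exists_eq_sum_dualSq_sub F
      refine ⟨⟨(K * ∑ i, ‖y i‖ ^ 2 - ∑ i, ‖x i‖ ^ 2 - r) • (0, 1), hmem _⟩,
        ι, inferInstance, x, y, ?_, ?_⟩
      · simpa using h
      · simp)
  have hg1 (r : ℝ) : g (0, r) = r := by
    have := hg ⟨r • (0, 1), hmem r⟩
    rw [hf] at this
    simpa using this
  have hgs (F : DualSqSpan X) (r : ℝ) : g (F, r) = g (F, 0) + r := by
    rw [← hg1 r, ← map_add]
    simp [hg1]
  refine ⟨g ∘ₗ LinearMap.inl ℝ _ _, fun x ↦ ⟨?_, ?_⟩⟩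
  · have := hg0 (dualSqMk x, -‖x‖ ^ 2) ⟨Unit, inferInstance, fun _ ↦ x, fun _ ↦ 0, by
      ext φ; simp [dualSq, dualSqMk], by simp⟩
    rw [hgs] at this
    simp only [LinearMap.comp_apply, LinearMap.inl_apply]
    linarith
  · have := hg0 (-dualSqMk x, K * ‖x‖ ^ 2) ⟨Unit, inferInstance, fun _ ↦ 0, fun _ ↦ x, by
      ext φ; simp [dualSq, dualSqMk], by simp⟩
    rw [hgs] at this
    have hneg : g (-dualSqMk x, 0) = - g (dualSqMk x, 0) := by
      rw [← map_neg]; simp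
    simp only [LinearMap.comp_apply, LinearMap.inl_apply]
    linarith

/-- The function `φ ↦ re (conj (φ x) * φ y)`, as an element of the span. -/
noncomputable def dualRe (x y : X) : DualSqSpan X :=
  (4⁻¹ : ℝ) • (dualSqMk (x + y) - dualSqMk (x - y))

lemma dualRe_apply (x y : X) (φ : StrongDual ℂ X) :
    (dualRe x y).1 φ = (star (φ x) * φ y).re := by
  simp [dualRe, dualSqMk, dualSq, Complex.sq_norm, Complex.normSq_apply]
  ring

/-- The sesquilinear form induced by a functional on the span of the rank-one tensors. -/
noncomputable def formOfFunctional (q : DualSqSpan X →ₗ[ℝ] ℝ) (x y : X) : ℂ :=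
  ⟨q (dualRe x y), q (dualRe (Complex.I • x) y)⟩

lemma dualRe_self (x : X) : dualRe x x = dualSqMk x := by
  ext φ
  rw [dualRe_apply]
  simp [dualSqMk, dualSq, Complex.sq_norm, Complex.normSq_apply]

/-- A functional bounded below by the square norm on rank-one tensors induces an inner product. -/
noncomputable abbrev coreOfFunctional (q : DualSqSpan X →ₗ[ℝ] ℝ)
    (hq : ∀ x, ‖x‖ ^ 2 ≤ q (dualSqMk x)) : InnerProductSpace.Core ℂ X where
  inner := formOfFunctional q
  conj_inner_symm x y := by
    have h1 : dualRe y x = dualRe x y := by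
      ext φ; simp only [dualRe_apply]; simp; ring
    have h2 : dualRe (Complex.I • y) x = - dualRe (Complex.I • x) y := by
      ext φ
      simp only [dualRe_apply, Submodule.coe_neg, Pi.neg_apply]
      simp; ring
    apply Complex.ext <;> simp [formOfFunctional, h1, h2]
  re_inner_nonneg x := by
    simpa [formOfFunctional, dualRe_self] using (sq_nonneg _).trans (hq x)
  add_left x y z := by
    have h (x y z : X) : dualRe (x + y) z = dualRe x z + dualRe y z := by
      ext φ
      simp only [dualRe_apply, Submodule.coe_add, Pi.add_apply]
      simp; ring
    apply Complex.ext <;> simp [formOfFunctional, h]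
  smul_left x y r := by
    have h1 : dualRe (r • x) y = r.re • dualRe x y + r.im • dualRe (Complex.I • x) y := by
      ext φ
      simp only [dualRe_apply, Submodule.coe_add, Pi.add_apply, Submodule.coe_smul, Pi.smul_apply]
      simp; ring
    have h2 : dualRe (Complex.I • r • x) y =
        r.re • dualRe (Complex.I • x) y - r.im • dualRe x y := by
      ext φ
      simp only [dualRe_apply, Submodule.coe_sub, Pi.sub_apply, Submodule.coe_smul, Pi.smul_apply]
      simp; ring
    apply Complex.ext <;> simp [formOfFunctional, h1, h2]
    ring
  definite x hx := by
    have h := congrArg Complex.re hx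
    simp only [formOfFunctional, dualRe_self, Complex.zero_re] at h
    have := hq x
    rw [h] at this
    simpa using this.antisymm (sq_nonneg _)

theorem exists_equiv_of_core {Y : Type v} [AddCommGroup Y] [Module ℂ Y]
    (c : InnerProductSpace.Core ℂ Y) (e : X ≃ₗ[ℂ] Y) {K : ℝ}
    (hl : ∀ x, ‖x‖ ^ 2 ≤ (c.inner (e x) (e x)).re)
    (hu : ∀ x, (c.inner (e x) (e x)).re ≤ K * ‖x‖ ^ 2) :
    ∃ (Z : Type v) (_ : NormedAddCommGroup Z) (_ : InnerProductSpace ℂ Z),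
      Nonempty (X ≃L[ℂ] Z) := by
  let _ := c.toNormedAddCommGroup
  let _ := InnerProductSpace.ofCore c.toCore
  have hn (x : X) : ‖e x‖ = √(c.inner (e x) (e x)).re := rfl
  refine ⟨Y, inferInstance, inferInstance, ⟨e.toContinuousLinearEquivOfBounds (√K) 1 ?_ ?_⟩⟩
  · intro x
    rw [hn]
    refine (Real.sqrt_le_sqrt (hu x)).trans_eq ?_
    rw [Real.sqrt_mul' _ (sq_nonneg _), Real.sqrt_sq (norm_nonneg x)]
  · intro y
    obtain ⟨x, rfl⟩ := e.surjective y
    rw [e.symm_apply_apply, hn, one_mul]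
    exact Real.le_sqrt_of_sq_le (hl x)
end Form

theorem sum_norm_sq_le_of_sum_dualSq_eq {ι X : Type*} [Fintype ι] [NormedAddCommGroup X]
    [NormedSpace ℂ X] {C : ℝ} (hC : 0 < C) (k : ι → ℤ)
    (hu : ∀ x : ι → X, trigEnergy k x ≤ C * ∑ j, ‖x j‖ ^ 2)
    (hl : ∀ x : ι → X, C⁻¹ * ∑ j, ‖x j‖ ^ 2 ≤ trigEnergy k x)
    {x y : ι → X} (h : ∑ i, dualSq (x i) = ∑ i, dualSq (y i)) :
    ∑ i, ‖x i‖ ^ 2 ≤ C ^ 2 * ∑ i, ‖y i‖ ^ 2 := by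
  obtain ⟨U, rfl⟩ := exists_unitaryAct_eq x y fun φ ↦ by
    simpa [dualSq] using congrFun h φ
  exact sum_norm_sq_unitaryAct_le hC k hu hl U y

theorem Finset.sum_Icc_extend_equivFin {ι M N : Type*} [Fintype ι] [AddCommMonoid M] [Zero N]
    (x : ι → N) (f : ℤ → N → M) (hf : ∀ k, f k 0 = 0) :
    ∑ k ∈ Finset.Icc (-(Fintype.card ι : ℤ)) (Fintype.card ι),
        f k (Function.extend (fun i ↦ ((Fintype.equivFin ι i : ℕ) : ℤ)) x 0 k) =
      ∑ i, f ((Fintype.equivFin ι i : ℕ) : ℤ) (x i) := by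
  classical
  have hinj : Function.Injective (fun i ↦ ((Fintype.equivFin ι i : ℕ) : ℤ)) := fun i j h ↦ by
    simpa [Fin.val_inj] using h
  rw [← Finset.sum_subset (s₁ := Finset.univ.image fun i ↦ ((Fintype.equivFin ι i : ℕ) : ℤ)),
    Finset.sum_image hinj.injOn]
  · simp only [hinj.extend_apply]
  · intro k hk
    obtain ⟨i, -, rfl⟩ := Finset.mem_image.1 hk
    have := (Fintype.equivFin ι i).2
    simp only [Finset.mem_Icc]
    constructor <;> omega
  · intro k _ hk
    rw [Function.extend_apply' _ _ _ (by simpa using hk), Pi.zero_apply, hf]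

/-- Kwapień's theorem: Let `X` be a complex Banach space such that for
some `C > 0`, for all `n` and all `x₋ₙ,…,xₙ ∈ X`,
`∫₀¹ ‖∑ₖ e^{2πikt} • xₖ‖² dt ≤ C ∑ₖ ‖xₖ‖²` and
`C⁻¹ ∑ₖ ‖xₖ‖² ≤ ∫₀¹ ‖∑ₖ e^{2πikt} • xₖ‖² dt`.
Then `X` is isomorphic to a Hilbert space. -/
theorem kwapien {X : Type u} [NormedAddCommGroup X] [NormedSpace ℂ X] [CompleteSpace X]
    (C : ℝ) (hC : 0 < C)
    (hupper : ∀ (n : ℕ) (x : ℤ → X),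
      ∫ t in (0:ℝ)..1,
          ‖∑ k ∈ Finset.Icc (-(n:ℤ)) (n:ℤ),
              Complex.exp (2 * π * Complex.I * k * t) • x k‖ ^ 2
        ≤ C * ∑ k ∈ Finset.Icc (-(n:ℤ)) (n:ℤ), ‖x k‖ ^ 2)
    (hlower : ∀ (n : ℕ) (x : ℤ → X),
      C⁻¹ * ∑ k ∈ Finset.Icc (-(n:ℤ)) (n:ℤ), ‖x k‖ ^ 2
        ≤ ∫ t in (0:ℝ)..1,
            ‖∑ k ∈ Finset.Icc (-(n:ℤ)) (n:ℤ),
                Complex.exp (2 * π * Complex.I * k * t) • x k‖ ^ 2) :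
    ∃ (Y : Type u) (_ : NormedAddCommGroup Y) (_ : InnerProductSpace ℂ Y),
      Nonempty (X ≃L[ℂ] Y) := by
  have htrig (ι : Type) [Fintype ι] (z : ι → X) := intervalIntegral.integral_congr
    (a := 0) (b := 1) (μ := volume) fun t _ ↦ congrArg (fun v : X ↦ ‖v‖ ^ 2)
      (Finset.sum_Icc_extend_equivFin z
        (fun k v ↦ Complex.exp (2 * π * Complex.I * k * (t : ℝ)) • v) (by simp))
  have hnorm (ι : Type) [Fintype ι] (z : ι → X) :=
    Finset.sum_Icc_extend_equivFin z (fun _ v ↦ ‖v‖ ^ 2) (by simp)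
  obtain ⟨q, hq⟩ := exists_functional_dualSq (X := X) (K := C ^ 2) fun ι _ x y h ↦
    sum_norm_sq_le_of_sum_dualSq_eq hC _
      (fun z ↦ (htrig ι z).symm.trans_le <| (hupper _ _).trans_eq <| by rw [hnorm])
      (fun z ↦ (by rw [hnorm] : _ = _).trans_le ((hlower _ _).trans_eq (htrig ι z))) h
  have hinner (x : X) : (formOfFunctional q x x).re = q (dualSqMk x) := by
    rw [formOfFunctional, dualRe_self]
  exact exists_equiv_of_core (coreOfFunctional q fun x ↦ (hq x).1) (LinearEquiv.refl ℂ X)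
    (fun x ↦ (hq x).1.trans_eq (hinner x).symm) (fun x ↦ (hinner x).trans_le (hq x).2)
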